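/- arXiv:2402.01501 — 2 statements merged into one kernel-verified Lean document; each statement's English description precedes it below -/
import Mathlib

section
/- Bilinear interpolation bounds powers from above: let c⁻, x, c⁺ be integers with 1 ≤ c⁻ ≤ x ≤ c⁺ and let d⁻, y, d⁺ be natural numbers with 1 ≤ d⁻ ≤ y ≤ d⁺. Then (c⁺ - c⁻)·(d⁺ - d⁻)·x^y ≤ (c⁺ - x)·(d⁺ - y)·(c⁻)^{d⁻} + (x - c⁻)·(d⁺ - y)·(c⁺)^{d⁻} + (c⁺ - x)·(y - d⁻)·(c⁻)^{d⁺} + (x - c⁻)·(y - d⁻)·(c⁺)^{d⁺}. -/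
/-- The secant bound expressing convexity of `x ↦ x ^ n` on the nonnegative integers. -/
theorem sub_mul_pow_le_secant {a x b : ℤ} (ha : 0 ≤ a) (hax : a ≤ x) (hxb : x ≤ b) (n : ℕ) :
    (b - a) * x ^ n ≤ (b - x) * a ^ n + (x - a) * b ^ n := by
  induction n with
  | zero => simp
  | succ n ih =>
    have hx : 0 ≤ x := ha.trans hax
    have hpow : a ^ n ≤ b ^ n := pow_le_pow_left₀ ha (hax.trans hxb) n
    have hgap : 0 ≤ (x - a) * (b - x) * (b ^ n - a ^ n) :=
      mul_nonneg (mul_nonneg (sub_nonneg.2 hax) (sub_nonneg.2 hxb)) (sub_nonneg.2 hpow)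
    have hmul := mul_le_mul_of_nonneg_right ih hx
    linear_combination hmul + hgap

theorem pow_sub_one_le_mul_pow_mul_sub_one {x : ℤ} (hx : 1 ≤ x) (n : ℕ) :
    x ^ n - 1 ≤ n * x ^ n * (x - 1) := by
  induction n with
  | zero => simp
  | succ n ih =>
    have hpow : 1 ≤ x ^ (n + 1) := one_le_pow₀ hx
    have hstep := mul_le_mul_of_nonneg_right hpow (sub_nonneg.2 hx)
    have hmul := mul_le_mul_of_nonneg_right ih (zero_le_one.trans hx)
    push_cast
    linear_combination hmul + hstep

/-- The secant bound expressing convexity of `n ↦ x ^ n` for an integer `x ≥ 1`. -/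
theorem sub_mul_pow_le_exponent_secant {x : ℤ} (hx : 1 ≤ x) {k m n : ℕ}
    (hkm : k ≤ m) (hmn : m ≤ n) :
    ((n : ℤ) - k) * x ^ m ≤ ((n : ℤ) - m) * x ^ k + ((m : ℤ) - k) * x ^ n := by
  obtain ⟨a, rfl⟩ := Nat.exists_eq_add_of_le hkm
  obtain ⟨b, rfl⟩ := Nat.exists_eq_add_of_le hmn
  have hx₀ : 0 ≤ x := zero_le_one.trans hx
  have hupper := mul_le_mul_of_nonneg_left (pow_sub_one_le_mul_pow_mul_sub_one hx a)
    (Int.natCast_nonneg b)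
  have hbernoulli : 1 + (b : ℤ) * (x - 1) ≤ x ^ b := by
    simpa using one_add_mul_le_pow (show (-2 : ℤ) ≤ x - 1 by linarith) b
  have hlower := mul_le_mul_of_nonneg_left hbernoulli
    (mul_nonneg (Int.natCast_nonneg a) (pow_nonneg hx₀ a))
  have hbase : ((a : ℤ) + b) * x ^ a ≤ b + a * (x ^ a * x ^ b) := by
    linear_combination hupper + hlower
  have hmul := mul_le_mul_of_nonneg_left hbase (pow_nonneg hx₀ k)
  push_cast
  simp only [pow_add]
  linear_combination hmul


theorem bilinear_interp_upper (cminus x cplus : ℤ) (hc : 1 ≤ cminus)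
    (hx₁ : cminus ≤ x) (hx₂ : x ≤ cplus) (dminus y dplus : ℕ)
    (hd : 1 ≤ dminus) (hy₁ : dminus ≤ y) (hy₂ : y ≤ dplus) :
    (cplus - cminus) * ((dplus : ℤ) - (dminus : ℤ)) * x ^ y ≤
      (cplus - x) * ((dplus : ℤ) - (y : ℤ)) * cminus ^ dminus
      + (x - cminus) * ((dplus : ℤ) - (y : ℤ)) * cplus ^ dminus
      + (cplus - x) * ((y : ℤ) - (dminus : ℤ)) * cminus ^ dplus
      + (x - cminus) * ((y : ℤ) - (dminus : ℤ)) * cplus ^ dplus := by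
  have hexponent := mul_le_mul_of_nonneg_left
    (sub_mul_pow_le_exponent_secant (hc.trans hx₁) hy₁ hy₂)
    (sub_nonneg.2 (hx₁.trans hx₂))
  have hc₀ : 0 ≤ cminus := zero_le_one.trans hc
  have hlow := mul_le_mul_of_nonneg_left (sub_mul_pow_le_secant hc₀ hx₁ hx₂ dminus)
    (sub_nonneg.2 (Nat.cast_le (α := ℤ).2 hy₂))
  have hhigh := mul_le_mul_of_nonneg_left (sub_mul_pow_le_secant hc₀ hx₁ hx₂ dplus)
    (sub_nonneg.2 (Nat.cast_le (α := ℤ).2 hy₁))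
  linear_combination hexponent + hlow + hhigh
end

section
/- Bilinear interpolation bounds powers from below: let c and d be natural numbers with c ≥ 1 and d ≥ 1, let x be an integer with x ≥ 1, and let y be a natural number with y ≥ d. Define L(k) = c^k + ((c+1)^k - c^k)·(x - c) for a natural number k. Then x^y ≥ L(d) + (L(d+1) - L(d))·(y - d), where c is viewed as an integer and y - d is the integer difference. -/
/-- If `u + (v - u) * (x - c)` is a nondecreasing chord lying below `w` at an integer `x ≥ 0`,
then the chord through `(c, c * u)` and `(c + 1, (c + 1) * v)` lies below `x * w` at `x`. -/
theorem chord_le_mul {c x u v w : ℤ} (hx : 0 ≤ x) (huv : u ≤ v)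
    (h : u + (v - u) * (x - c) ≤ w) :
    c * u + ((c + 1) * v - c * u) * (x - c) ≤ x * w := by
  have hsq : 0 ≤ (x - c) * (x - c) - (x - c) := by
    rcases le_or_gt (x - c) 0 with ht | ht <;> nlinarith
  have h₁ := mul_le_mul_of_nonneg_left h hx
  have h₂ := mul_nonneg (sub_nonneg.mpr huv) hsq
  linarith

theorem chord_le_pow_mul {c x u v w : ℤ} (hc : 0 ≤ c) (hx : 0 ≤ x) (hu : 0 ≤ u)
    (huv : u ≤ v) (h : u + (v - u) * (x - c) ≤ w) (d : ℕ) :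
    c ^ d * u + ((c + 1) ^ d * v - c ^ d * u) * (x - c) ≤ x ^ d * w := by
  induction d with
  | zero => simpa using h
  | succ d ih =>
    have hmono : c ^ d * u ≤ (c + 1) ^ d * v := by
      gcongr
      linarith
    have := chord_le_mul hx hmono ih
    simpa only [pow_succ', mul_assoc] using this

theorem one_add_mul_sub_one_le_pow {x : ℤ} (hx : 1 ≤ x) (n : ℕ) :
    1 + (x - 1) * n ≤ x ^ n := by
  have := one_add_mul_le_pow (a := x - 1) (by linarith) n
  rw [add_sub_cancel] at this
  linarith

theorem bilinear_interp_lower (c d : ℕ) (hc : c ≥ 1) (hd : d ≥ 1)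
    (x : ℤ) (hx : x ≥ 1) (y : ℕ) (hy : y ≥ d) :
    x ^ y ≥
      ((c : ℤ) ^ d + (((c : ℤ) + 1) ^ d - (c : ℤ) ^ d) * (x - c))
      + (((c : ℤ) ^ (d + 1) + (((c : ℤ) + 1) ^ (d + 1) - (c : ℤ) ^ (d + 1)) * (x - c))
          - ((c : ℤ) ^ d + (((c : ℤ) + 1) ^ d - (c : ℤ) ^ d) * (x - c)))
        * ((y : ℤ) - (d : ℤ)) := by
  obtain ⟨n, rfl⟩ := Nat.exists_eq_add_of_le hy
  have hc' : (1 : ℤ) ≤ c := by exact_mod_cast hc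
  have hx₀ : 0 ≤ x := by linarith
  have h₁ := chord_le_pow_mul (c := c) (x := x) (u := 1) (v := 1) (w := 1)
    (by linarith) hx₀ (by norm_num) le_rfl (by simp) d
  have h₂ := chord_le_pow_mul (c := c) (x := x) (u := c - 1) (v := c) (w := x - 1)
    (by linarith) hx₀ (by linarith) (by linarith) (by linarith) d
  have h₃ := mul_le_mul_of_nonneg_left (one_add_mul_sub_one_le_pow hx n) (pow_nonneg hx₀ d)
  have h₄ := mul_le_mul_of_nonneg_right h₂ (Int.natCast_nonneg n)
  rw [pow_add, pow_succ, pow_succ]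
  push_cast
  linarith
end
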